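/- (Smoothing sandwich for Lipschitz convex functions.) Let f : ℝ^d → ℝ be convex and L-Lipschitz with respect to the Euclidean norm, let μ > 0, and let u be uniformly distributed on the closed Euclidean ball of radius √(d+2) centered at the origin. Define f_μ(w) = E_u[f(w + μu)]. Then for every w ∈ ℝ^d, f(w) ≤ f_μ(w) ≤ f(w) + μ·L·√(d+2). -/

import Mathlib

open MeasureTheory

section Smoothing

variable {E : Type*} [NormedAddCommGroup E] [MeasurableSpace E]

/-- The restriction of a reflection-invariant measure to a centered ball is
reflection-invariant. -/
lemma isNegInvariant_restrict_closedBall [BorelSpace E] (m : Measure E) [m.IsNegInvariant]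
    (r : ℝ) : (m.restrict (Metric.closedBall 0 r)).IsNegInvariant := by
  constructor
  have h := (Measure.measurePreserving_neg m).restrict_preimage
    (Metric.isClosed_closedBall (x := (0 : E)) (ε := r)).measurableSet
  have hpre : (Neg.neg ⁻¹' Metric.closedBall (0 : E) r) = Metric.closedBall 0 r := by
    ext x
    simp
  rw [hpre] at h
  exact h.map_eq

/-- A convex function is bounded above by its averages over symmetric perturbations. -/
lemma ConvexOn.le_integral_add_smul [NormedSpace ℝ E] [BorelSpace E] {f : E → ℝ}
    (hf : ConvexOn ℝ Set.univ f) (m : Measure E) [IsProbabilityMeasure m] [m.IsNegInvariant]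
    (c : ℝ) (w : E) (hint : Integrable (fun u ↦ f (w + c • u)) m) :
    f w ≤ ∫ u, f (w + c • u) ∂m := by
  have hneg : ∫ u, f (w + c • -u) ∂m = ∫ u, f (w + c • u) ∂m :=
    integral_neg_eq_self (fun u ↦ f (w + c • u)) m
  have hint' : Integrable (fun u ↦ f (w + c • -u)) m := hint.comp_neg
  have hpt (u : E) : 2 * f w ≤ f (w + c • u) + f (w + c • -u) := by
    have h := hf.2 (Set.mem_univ (w + c • u)) (Set.mem_univ (w + c • -u))
      (by norm_num : (0 : ℝ) ≤ 1 / 2) (by norm_num : (0 : ℝ) ≤ 1 / 2) (by norm_num)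
    have hmid : (1 / 2 : ℝ) • (w + c • u) + (1 / 2 : ℝ) • (w + c • -u) = w := by module
    rw [hmid, smul_eq_mul, smul_eq_mul] at h
    linarith
  have h := integral_mono (integrable_const (2 * f w)) (hint.add hint') hpt
  simp only [Pi.add_apply] at h
  rw [integral_add hint hint', hneg, integral_const, probReal_univ, one_smul] at h
  linarith

end Smoothing

/-- Smoothing sandwich for Lipschitz convex functions.  Let `f : ℝ^d → ℝ` be convex and
`L`-Lipschitz for the Euclidean norm, `μ > 0`, and let `ν` be the uniform (normalized Lebesgue)
probability measure on the closed Euclidean ball of radius `√(d+2)` centered at the origin.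
With `f_μ(w) = E_{u∼ν}[f(w + μu)]`, for every `w`: `f(w) ≤ f_μ(w) ≤ f(w) + μ·L·√(d+2)`. -/
theorem stmt_9 (d : ℕ) (hd : 1 ≤ d)
    (f : EuclideanSpace ℝ (Fin d) → ℝ)
    (hconv : ConvexOn ℝ Set.univ f)
    (L : ℝ) (hLip : ∀ x y, |f x - f y| ≤ L * ‖x - y‖)
    (μs : ℝ) (hμs : 0 < μs)
    (ν : Measure (EuclideanSpace ℝ (Fin d)))
    (hν : ν = (volume (Metric.closedBall (0 : EuclideanSpace ℝ (Fin d))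
        (Real.sqrt ((d : ℝ) + 2))))⁻¹ •
      volume.restrict (Metric.closedBall (0 : EuclideanSpace ℝ (Fin d))
        (Real.sqrt ((d : ℝ) + 2))))
    (w : EuclideanSpace ℝ (Fin d)) :
    f w ≤ ∫ u, f (w + μs • u) ∂ν ∧
    ∫ u, f (w + μs • u) ∂ν ≤ f w + μs * L * Real.sqrt ((d : ℝ) + 2) := by
  set r : ℝ := Real.sqrt ((d : ℝ) + 2)
  set B := Metric.closedBall (0 : EuclideanSpace ℝ (Fin d)) r
  have hr0 : 0 < r := Real.sqrt_pos.2 (by positivity)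
  have hB0 : volume B ≠ 0 := (Metric.measure_closedBall_pos volume _ hr0).ne'
  have hBtop : volume B ≠ ⊤ := measure_closedBall_lt_top.ne
  have hprob : IsProbabilityMeasure ν := by
    constructor
    simp [hν, ENNReal.inv_mul_cancel hB0 hBtop]
  have hsymm : ν.IsNegInvariant := by
    have := isNegInvariant_restrict_closedBall
      (volume : Measure (EuclideanSpace ℝ (Fin d))) r
    constructor
    rw [hν, Measure.neg_def, Measure.map_smul, ← Measure.neg_def, Measure.neg_eq_self]
  have hball : ∀ᵐ u ∂ν, u ∈ B := by
    rw [hν]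
    exact Measure.ae_smul_measure (ae_restrict_mem Metric.isClosed_closedBall.measurableSet) _
  have hL : 0 ≤ L := by
    have h := (abs_nonneg _).trans
      (hLip (EuclideanSpace.single (⟨0, hd⟩ : Fin d) (1 : ℝ)) 0)
    simpa using h
  have hbound : ∀ᵐ u ∂ν, |f (w + μs • u) - f w| ≤ μs * L * r := by
    filter_upwards [hball] with u hu
    have hu' : ‖u‖ ≤ r := by simpa [B] using hu
    calc |f (w + μs • u) - f w| ≤ L * ‖w + μs • u - w‖ := hLip _ _
      _ = μs * L * ‖u‖ := by
        rw [add_sub_cancel_left, norm_smul, Real.norm_of_nonneg hμs.le]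
        ring
      _ ≤ μs * L * r := by gcongr
  have hcont : Continuous f :=
    (LipschitzWith.of_dist_le_mul (K := ⟨L, hL⟩) fun x y ↦ by
      rw [Real.dist_eq, dist_eq_norm]
      exact hLip x y).continuous
  have hint : Integrable (fun u ↦ f (w + μs • u)) ν := by
    refine Integrable.of_bound (by fun_prop) (|f w| + μs * L * r) ?_
    filter_upwards [hbound] with u hu
    rw [Real.norm_eq_abs]
    linarith [abs_sub_abs_le_abs_sub (f (w + μs • u)) (f w)]
  refine ⟨hconv.le_integral_add_smul ν μs w hint, ?_⟩
  have hupper := integral_mono_ae hint (integrable_const (f w + μs * L * r)) (by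
    filter_upwards [hbound] with u hu
    linarith [le_abs_self (f (w + μs • u) - f w)])
  simpa using hupper
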